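/- (Controller perturbation for iterative learning control.) Suppose σ̲(R) ≥ 1, ‖A_t − Â_t‖ ≤ ε_A and ‖B_t − B̂_t‖ ≤ ε_B for all t = 0,…,H−1, that R + B̂_tᵀ P^ILC_{t+1} B_t is invertible with ‖(R + B̂_tᵀ P^ILC_{t+1} B_t)v‖ ≥ σ̲(R)‖v‖ for all v, and ‖P*_{t+1} − P^ILC_{t+1}‖ ≤ f_{t+1} for some f_{t+1} ≥ 0, where ε_A, ε_B, f_{t+1} are all strictly less than Γ. Then for all t = 0,…,H−1, ‖K*_t − K^ILC_t‖ ≤ 6Γ³ε_t, where ε_t = max{ε_A, ε_B, f_{t+1}}. -/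

import Mathlib

open Matrix

/-- The operator norm of a real matrix induced by the Euclidean vector norm. -/
noncomputable def mnorm {m n : ℕ} (A : Matrix (Fin m) (Fin n) ℝ) : ℝ :=
  ‖LinearMap.toContinuousLinearMap (Matrix.toEuclideanLin A)‖

/-- The Euclidean norm of a real vector. -/
noncomputable def vnorm {n : ℕ} (x : Fin n → ℝ) : ℝ :=
  Real.sqrt (∑ i, x i ^ 2)

open scoped Matrix.Norms.L2Operator in
lemma mnorm_eq {m n : ℕ} (A : Matrix (Fin m) (Fin n) ℝ) : mnorm A = ‖A‖ := by
  rw [Matrix.l2_opNorm_def]; rfl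

open scoped Matrix.Norms.L2Operator in
lemma mnorm_nonneg {m n : ℕ} (A : Matrix (Fin m) (Fin n) ℝ) : 0 ≤ mnorm A := norm_nonneg _

open scoped Matrix.Norms.L2Operator in
lemma mnorm_add {m n : ℕ} (A B : Matrix (Fin m) (Fin n) ℝ) :
    mnorm (A + B) ≤ mnorm A + mnorm B := by
  simp only [mnorm_eq]; exact norm_add_le _ _

open scoped Matrix.Norms.L2Operator in
lemma mnorm_sub_comm {m n : ℕ} (A B : Matrix (Fin m) (Fin n) ℝ) :
    mnorm (A - B) = mnorm (B - A) := by
  simp only [mnorm_eq]; exact norm_sub_rev _ _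

open scoped Matrix.Norms.L2Operator in
lemma mnorm_mul {m n k : ℕ} (A : Matrix (Fin m) (Fin n) ℝ) (B : Matrix (Fin n) (Fin k) ℝ) :
    mnorm (A * B) ≤ mnorm A * mnorm B := by
  simp only [mnorm_eq]; exact Matrix.l2_opNorm_mul _ _

open scoped Matrix.Norms.L2Operator in
lemma mnorm_transpose {m n : ℕ} (A : Matrix (Fin m) (Fin n) ℝ) : mnorm Aᵀ = mnorm A := by
  simp only [mnorm_eq]
  rw [← Matrix.l2_opNorm_conjTranspose A, Matrix.conjTranspose_eq_transpose_of_trivial]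

lemma vnorm_eq {n : ℕ} (x : Fin n → ℝ) : vnorm x = ‖(WithLp.toLp 2 x : EuclideanSpace ℝ (Fin n))‖ := by
  simp [vnorm, EuclideanSpace.norm_eq]

open scoped Matrix.Norms.L2Operator in
lemma mnorm_le_of_lower {d n : ℕ} (M : Matrix (Fin d) (Fin d) ℝ) (X : Matrix (Fin d) (Fin n) ℝ)
    (h : ∀ v : Fin d → ℝ, vnorm v ≤ vnorm (M.mulVec v)) : mnorm X ≤ mnorm (M * X) := by
  refine ContinuousLinearMap.opNorm_le_bound _ (norm_nonneg _) fun v => ?_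
  have h1 := h (X.mulVec v.ofLp)
  rw [Matrix.mulVec_mulVec, vnorm_eq, vnorm_eq] at h1
  refine h1.trans ?_
  exact (LinearMap.toContinuousLinearMap (Matrix.toEuclideanLin (M * X))).le_opNorm v

lemma posDef_step {n d : ℕ} (A P Q : Matrix (Fin n) (Fin n) ℝ) (B : Matrix (Fin n) (Fin d) ℝ)
    (R : Matrix (Fin d) (Fin d) ℝ) (hQ : Q.PosDef) (hR : R.PosDef) (hP : P.PosDef) :
    (Q + Aᵀ * P * (1 + B * R⁻¹ * Bᵀ * P)⁻¹ * A).PosDef := by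
  have hS : (B * R⁻¹ * Bᵀ).PosSemidef := by
    have := hR.inv.posSemidef.mul_mul_conjTranspose_same B
    rwa [Matrix.conjTranspose_eq_transpose_of_trivial] at this
  have hN : (P⁻¹ + B * R⁻¹ * Bᵀ).PosDef := hP.inv.add_posSemidef hS
  have hu : IsUnit P.det := (Matrix.isUnit_iff_isUnit_det _).1 hP.isUnit
  have e : 1 + B * R⁻¹ * Bᵀ * P = (P⁻¹ + B * R⁻¹ * Bᵀ) * P := by
    rw [Matrix.add_mul, Matrix.nonsing_inv_mul _ hu]
  have e2 : Aᵀ * P * (1 + B * R⁻¹ * Bᵀ * P)⁻¹ * A = Aᵀ * (P⁻¹ + B * R⁻¹ * Bᵀ)⁻¹ * A := by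
    rw [e, Matrix.mul_inv_rev, Matrix.mul_assoc Aᵀ, Matrix.mul_nonsing_inv_cancel_left _ _ hu]
  rw [e2]
  refine hQ.add_posSemidef ?_
  have := hN.inv.posSemidef.conjTranspose_mul_mul_same A
  rwa [Matrix.conjTranspose_eq_transpose_of_trivial] at this

/-- Lemma 3 of the paper: controller perturbation for iterative learning
control. If `σ̲(R) ≥ 1`, the model errors are at most `ε_A, ε_B`, each
`R + B̂_tᵀ P^ILC_{t+1} B_t` is invertible with all singular values at least `σ̲(R)`, and
`‖P*_{t+1} - P^ILC_{t+1}‖ ≤ f_{t+1}` with `ε_A, ε_B, f_{t+1} < Γ` nonnegative, then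
`‖K*_t - K^ILC_t‖ ≤ 6 Γ³ ε_t` with `ε_t = max{ε_A, ε_B, f_{t+1}}`. -/
theorem statement11
    (n d H : ℕ)
    (A Ahat : ℕ → Matrix (Fin n) (Fin n) ℝ) (B Bhat : ℕ → Matrix (Fin n) (Fin d) ℝ)
    (Q Qf : Matrix (Fin n) (Fin n) ℝ) (R : Matrix (Fin d) (Fin d) ℝ)
    (hQ : Q.PosDef) (hQf : Qf.PosDef) (hR : R.PosDef)
    -- `σR` is a lower bound on the singular values of `R`, with `σR ≥ 1`
    (σR : ℝ) (hσR1 : 1 ≤ σR)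
    (hσR : ∀ v : Fin d → ℝ, σR * vnorm v ≤ vnorm (R.mulVec v))
    (Pstar PILC : ℕ → Matrix (Fin n) (Fin n) ℝ)
    (Kstar KILC : ℕ → Matrix (Fin d) (Fin n) ℝ)
    -- optimal Riccati recursion
    (hPH : Pstar H = Qf)
    (hP : ∀ t, t < H → Pstar t =
      Q + (A t)ᵀ * Pstar (t+1) * (1 + B t * R⁻¹ * (B t)ᵀ * Pstar (t+1))⁻¹ * A t)
    (hK : ∀ t, t < H → Kstar t =
      -((R + (B t)ᵀ * Pstar (t+1) * B t)⁻¹ * ((B t)ᵀ * Pstar (t+1) * A t)))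
    -- ILC recursion
    (hPILCH : PILC H = Qf)
    (hPILC : ∀ t, t < H → PILC t =
      Q + (Ahat t)ᵀ * PILC (t+1) *
        (1 + B t * R⁻¹ * (Bhat t)ᵀ * PILC (t+1))⁻¹ * A t)
    (hKILC : ∀ t, t < H → KILC t =
      -((R + (Bhat t)ᵀ * PILC (t+1) * B t)⁻¹ * ((Bhat t)ᵀ * PILC (t+1) * A t)))
    -- invertibility and singular-value lower bound for `R + B̂ᵀ P^ILC B`
    (hinv : ∀ t, t < H → IsUnit (R + (Bhat t)ᵀ * PILC (t+1) * B t))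
    (hσM : ∀ t, t < H → ∀ v : Fin d → ℝ,
      σR * vnorm v ≤ vnorm ((R + (Bhat t)ᵀ * PILC (t+1) * B t).mulVec v))
    -- `Γ = 1 + max_t {‖A_t‖, ‖B_t‖, ‖P*_t‖, ‖K*_t‖}` (as an upper bound)
    (Γ : ℝ)
    (hΓA : ∀ t, t < H → 1 + mnorm (A t) ≤ Γ)
    (hΓB : ∀ t, t < H → 1 + mnorm (B t) ≤ Γ)
    (hΓP : ∀ t, t ≤ H → 1 + mnorm (Pstar t) ≤ Γ)
    (hΓK : ∀ t, t < H → 1 + mnorm (Kstar t) ≤ Γ)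
    -- modeling errors
    (εA εB : ℝ)
    (hεA : ∀ t, t < H → mnorm (A t - Ahat t) ≤ εA)
    (hεB : ∀ t, t < H → mnorm (B t - Bhat t) ≤ εB)
    (hεA0 : 0 ≤ εA) (hεB0 : 0 ≤ εB) (hεAΓ : εA < Γ) (hεBΓ : εB < Γ)
    -- bound on the value-matrix perturbation
    (f : ℕ → ℝ)
    (hf : ∀ t, t < H → mnorm (Pstar (t+1) - PILC (t+1)) ≤ f (t+1))
    (hf0 : ∀ t, t < H → 0 ≤ f (t+1))
    (hfΓ : ∀ t, t < H → f (t+1) < Γ) :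
    ∀ t, t < H →
      mnorm (Kstar t - KILC t) ≤ 6 * Γ ^ 3 * max (max εA εB) (f (t+1)) := by
  intro t ht
  have hpd : ∀ k, k ≤ H → (Pstar (H - k)).PosDef := by
    intro k
    induction k with
    | zero => intro _; simpa [hPH] using hQf
    | succ k ih =>
      intro hk
      rw [hP (H - (k+1)) (by omega)]
      have e : H - (k+1) + 1 = H - k := by omega
      rw [e]
      exact posDef_step _ _ _ _ _ hQ hR (ih (by omega))
  have hPt : (Pstar (t+1)).PosDef := by
    have := hpd (H - (t+1)) (by omega)
    rwa [show H - (H - (t+1)) = t + 1 by omega] at this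
  have hM : IsUnit (R + (B t)ᵀ * Pstar (t+1) * B t).det := by
    refine (Matrix.isUnit_iff_isUnit_det _).1 (Matrix.PosDef.isUnit (hR.add_posSemidef ?_))
    have := hPt.posSemidef.conjTranspose_mul_mul_same (B t)
    rwa [Matrix.conjTranspose_eq_transpose_of_trivial] at this
  have hM' := (Matrix.isUnit_iff_isUnit_det _).1 (hinv t ht)
  have eK : (R + (B t)ᵀ * Pstar (t+1) * B t) * Kstar t = -((B t)ᵀ * Pstar (t+1) * A t) := by
    rw [hK t ht, Matrix.mul_neg, Matrix.mul_nonsing_inv_cancel_left _ _ hM]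
  have eK' : (R + (Bhat t)ᵀ * PILC (t+1) * B t) * KILC t = -((Bhat t)ᵀ * PILC (t+1) * A t) := by
    rw [hKILC t ht, Matrix.mul_neg, Matrix.mul_nonsing_inv_cancel_left _ _ hM']
  have key : (R + (Bhat t)ᵀ * PILC (t+1) * B t) * (Kstar t - KILC t) =
      ((Bhat t - B t)ᵀ * Pstar (t+1) + (Bhat t)ᵀ * (PILC (t+1) - Pstar (t+1))) *
        (B t * Kstar t + A t) := by
    have e3 : (Bhat t - B t)ᵀ * Pstar (t+1) + (Bhat t)ᵀ * (PILC (t+1) - Pstar (t+1)) =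
        (Bhat t)ᵀ * PILC (t+1) - (B t)ᵀ * Pstar (t+1) := by
      rw [Matrix.transpose_sub, Matrix.sub_mul, Matrix.mul_sub]; abel
    have e4 : R * Kstar t = -((B t)ᵀ * Pstar (t+1) * A t) - (B t)ᵀ * Pstar (t+1) * B t * Kstar t := by
      rw [← eK, Matrix.add_mul]; abel
    rw [e3, Matrix.mul_sub, eK', Matrix.add_mul, e4, Matrix.sub_mul, Matrix.mul_add, Matrix.mul_add]
    simp only [Matrix.mul_assoc]
    abel
  have h0 := mnorm_le_of_lower (R + (Bhat t)ᵀ * PILC (t+1) * B t) (Kstar t - KILC t) (fun v => by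
    refine le_trans ?_ (hσM t ht v)
    exact le_mul_of_one_le_left (Real.sqrt_nonneg _) hσR1)
  rw [key] at h0
  set ε := max (max εA εB) (f (t+1)) with hε
  have hBε : εB ≤ ε := (le_max_right _ _).trans (le_max_left _ _)
  have hfε : f (t+1) ≤ ε := le_max_right _ _
  have hε0 : 0 ≤ ε := hεB0.trans hBε
  have a1 := hΓA t ht
  have a2 := hΓB t ht
  have a3 := hΓP (t+1) ht
  have a4 := hΓK t ht
  have hG : 1 ≤ Γ := by linarith [mnorm_nonneg (A t)]
  have b1 : mnorm (Bhat t - B t) ≤ εB := by rw [mnorm_sub_comm]; exact hεB t ht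
  have b2 : mnorm (Bhat t) ≤ 2 * Γ := by
    have := mnorm_add (Bhat t - B t) (B t)
    rw [sub_add_cancel] at this
    linarith
  have b3 : mnorm (PILC (t+1) - Pstar (t+1)) ≤ ε := by
    rw [mnorm_sub_comm]; exact (hf t ht).trans hfε
  have c1 : mnorm ((Bhat t - B t)ᵀ * Pstar (t+1) + (Bhat t)ᵀ * (PILC (t+1) - Pstar (t+1)))
      ≤ ε * Γ + 2 * Γ * ε := by
    refine (mnorm_add _ _).trans (add_le_add ?_ ?_)
    · refine (mnorm_mul _ _).trans ?_
      rw [mnorm_transpose]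
      exact mul_le_mul (b1.trans hBε) (by linarith) (mnorm_nonneg _) hε0
    · refine (mnorm_mul _ _).trans ?_
      rw [mnorm_transpose]
      exact mul_le_mul b2 b3 (mnorm_nonneg _) (by linarith)
  have c2 : mnorm (B t * Kstar t + A t) ≤ Γ * Γ + Γ := by
    refine (mnorm_add _ _).trans (add_le_add ((mnorm_mul _ _).trans ?_) (by linarith))
    exact mul_le_mul (by linarith) (by linarith) (mnorm_nonneg _) (by linarith)
  have c3 := mul_le_mul c1 c2 (mnorm_nonneg _) (by positivity)
  refine (h0.trans (mnorm_mul _ _)).trans (c3.trans ?_)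
  have : 0 ≤ 3 * ε * Γ ^ 2 * (Γ - 1) := mul_nonneg (by positivity) (by linarith)
  nlinarith
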